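/- For every ground program P over a type α of atoms, the sequence of possible (unknown) sets of the alternating fixpoint procedure is decreasing: U_{i+1} ⊆ U_i for all i ≥ 0. -/

import Mathlib

/-- A ground rule: head atom, finite set of positive subgoals, finite set of negative subgoals. -/
structure GroundRule (α : Type*) where
  head : α
  pos : Finset α
  neg : Finset α

/-- The extended immediate consequence operator `T_{P,J}(I)`. -/
def Tstep {α : Type*} (P : Set (GroundRule α)) (J I : Set α) : Set α :=
  {a | ∃ r ∈ P, r.head = a ∧ ↑r.pos ⊆ I ∧ (↑r.neg ∩ J : Set α) = ∅}

lemma Tstep_mono {α : Type*} (P : Set (GroundRule α)) (J : Set α) : Monotone (Tstep P J) := by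
  rintro I I' h a ⟨r, hr, hh, hpos, hneg⟩
  exact ⟨r, hr, hh, hpos.trans h, hneg⟩

/-- `T_{P,J}` bundled as a monotone map on the complete lattice of subsets of `α`. -/
def TstepHom {α : Type*} (P : Set (GroundRule α)) (J : Set α) : Set α →o Set α :=
  ⟨Tstep P J, Tstep_mono P J⟩

/-- The least fixed point of `I ↦ T_{P,J}(I)` (Knaster–Tarski). -/
def Tlfp {α : Type*} (P : Set (GroundRule α)) (J : Set α) : Set α :=
  OrderHom.lfp (TstepHom P J)

/-- The definite part `P⁺` of `P`: the rules with no negative subgoals. -/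
def definitePart {α : Type*} (P : Set (GroundRule α)) : Set (GroundRule α) :=
  {r ∈ P | r.neg = ∅}

/-- The alternating fixpoint sequence `(K_i, U_i)`:
`K₀ := lfp (T_{P⁺,∅})`, `U₀ := lfp (T_{P,K₀})`, and for `i > 0`,
`K_i := lfp (T_{P,U_{i-1}})`, `U_i := lfp (T_{P,K_i})`. -/
def AFP {α : Type*} (P : Set (GroundRule α)) : ℕ → Set α × Set α
  | 0 => (Tlfp (definitePart P) ∅, Tlfp P (Tlfp (definitePart P) ∅))
  | i + 1 => (Tlfp P (AFP P i).2, Tlfp P (Tlfp P (AFP P i).2))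

/-- The true (known) sets `K_i` of the alternating fixpoint procedure. -/
def Kseq {α : Type*} (P : Set (GroundRule α)) (i : ℕ) : Set α := (AFP P i).1

/-- The possible (unknown) sets `U_i` of the alternating fixpoint procedure. -/
def Useq {α : Type*} (P : Set (GroundRule α)) (i : ℕ) : Set α := (AFP P i).2

theorem Tlfp_mono_of_Tstep_subset {α : Type*} {P Q : Set (GroundRule α)} {J J' : Set α}
    (h : ∀ I, Tstep P J I ⊆ Tstep Q J' I) : Tlfp P J ⊆ Tlfp Q J' :=
  OrderHom.lfp.monotone (show TstepHom P J ≤ TstepHom Q J' from h)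

theorem Tlfp_antitone {α : Type*} (P : Set (GroundRule α)) : Antitone (Tlfp P) := by
  intro J J' h
  refine Tlfp_mono_of_Tstep_subset ?_
  rintro I a ⟨r, hr, hh, hpos, hneg⟩
  exact ⟨r, hr, hh, hpos, Set.subset_empty_iff.mp
    ((Set.inter_subset_inter_right _ h).trans hneg.subset)⟩

theorem Tlfp_definitePart_subset {α : Type*} (P : Set (GroundRule α)) (J J' : Set α) :
    Tlfp (definitePart P) J ⊆ Tlfp P J' := by
  refine Tlfp_mono_of_Tstep_subset ?_
  rintro I a ⟨r, ⟨hr, hr_neg⟩, hh, hpos, -⟩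
  exact ⟨r, hr, hh, hpos, by simp [hr_neg]⟩

theorem Useq_eq_Tlfp_Kseq {α : Type*} (P : Set (GroundRule α)) (i : ℕ) :
    Useq P i = Tlfp P (Kseq P i) := by
  cases i <;> rfl

theorem Kseq_subset_succ {α : Type*} (P : Set (GroundRule α)) (i : ℕ) :
    Kseq P i ⊆ Kseq P (i + 1) := by
  induction i with
  | zero => exact Tlfp_definitePart_subset P _ _
  | succ i ih =>
    refine Tlfp_antitone P (show Useq P (i + 1) ⊆ Useq P i from ?_)
    rw [Useq_eq_Tlfp_Kseq, Useq_eq_Tlfp_Kseq]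
    exact Tlfp_antitone P ih

/-- The sequence of possible (unknown) sets of the alternating fixpoint procedure is decreasing. -/
theorem Useq_decreasing {α : Type*} (P : Set (GroundRule α)) (i : ℕ) :
    Useq P (i + 1) ⊆ Useq P i := by
  rw [Useq_eq_Tlfp_Kseq, Useq_eq_Tlfp_Kseq]
  exact Tlfp_antitone P (Kseq_subset_succ P i)
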